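/- For every natural number p ≥ 1 there exists a constant C > 0, depending only on p, such that for every bivariate polynomial q of total degree ≤ p the following holds on the unit square K = (0,1)². For each of the four edges e of K let γ_e : [0,1] → ℝ² be the affine arclength parametrization of e. For every multi-index α = (α₁, α₂) with |α| = α₁ + α₂ ≤ p − 2 let m_α(x,y) = (x − 1/2)^{α₁} (y − 1/2)^{α₂}. Then ∫_K |∇q|² dx dy ≤ C ( Σ_{e} Σ_{j=0}^{p−1} ( ∫₀¹ q(γ_e(t)) t^j dt )² + Σ_{|α| ≤ p−2} ( ∫_K m_α q dx dy )² ), the outer sum running over the four edges of K. -/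

import Mathlib

open MeasureTheory

/-- Evaluation of a bivariate polynomial at a point of `ℝ × ℝ`. -/
noncomputable def evP (q : MvPolynomial (Fin 2) ℝ) (z : ℝ × ℝ) : ℝ :=
  MvPolynomial.eval ![z.1, z.2] q

/-- Squared Euclidean norm of the gradient of a bivariate polynomial. -/
noncomputable def gradSqP (q : MvPolynomial (Fin 2) ℝ) (z : ℝ × ℝ) : ℝ :=
  (evP (MvPolynomial.pderiv (0 : Fin 2) q) z) ^ 2 +
    (evP (MvPolynomial.pderiv (1 : Fin 2) q) z) ^ 2

/-- Affine arclength parametrizations of the four edges of the unit square. -/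
noncomputable def edgeParam : Fin 4 → ℝ → ℝ × ℝ
  | 0 => fun t => (t, 0)
  | 1 => fun t => (1, t)
  | 2 => fun t => (t, 1)
  | 3 => fun t => (0, t)

/-- The multi-indices `α = (α₁, α₂)` with `|α| = α₁ + α₂ ≤ p − 2`
(empty when `p = 1`, since then `p − 2 = −1 < 0`). -/
def momIdx (p : ℕ) : Finset (ℕ × ℕ) :=
  (Finset.range (p + 1) ×ˢ Finset.range (p + 1)).filter
    (fun ab => (ab.1 : ℤ) + (ab.2 : ℤ) ≤ (p : ℤ) - 2)

/-- The scaled monomial `m_α` centered at the centroid `(1/2, 1/2)` of the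
unit square. -/
noncomputable def monC (ab : ℕ × ℕ) (z : ℝ × ℝ) : ℝ :=
  (z.1 - 1 / 2) ^ ab.1 * (z.2 - 1 / 2) ^ ab.2

theorem evP_cont (q : MvPolynomial (Fin 2) ℝ) : Continuous (evP q) := by
  unfold evP
  have h : Continuous (fun z : ℝ × ℝ => (![z.1, z.2] : Fin 2 → ℝ)) := by
    refine continuous_pi fun i => ?_
    fin_cases i
    · exact continuous_fst
    · exact continuous_snd
  exact (MvPolynomial.continuous_eval q).comp h

theorem evP_add (q r : MvPolynomial (Fin 2) ℝ) (z) : evP (q + r) z = evP q z + evP r z := by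
  simp [evP]

theorem evP_mul (q r : MvPolynomial (Fin 2) ℝ) (z) : evP (q * r) z = evP q z * evP r z := by
  simp [evP]

theorem evP_smul (c : ℝ) (r : MvPolynomial (Fin 2) ℝ) (z) : evP (c • r) z = c * evP r z := by
  simp [evP]

theorem evP_sum {ι : Type*} (s : Finset ι) (f : ι → MvPolynomial (Fin 2) ℝ) (z) :
    evP (∑ i ∈ s, f i) z = ∑ i ∈ s, evP (f i) z := by
  simp [evP]

theorem evP_monomial (m : Fin 2 →₀ ℕ) (c : ℝ) (z : ℝ × ℝ) :
    evP (MvPolynomial.monomial m c) z = c * (z.1 ^ m 0 * z.2 ^ m 1) := by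
  simp [evP, MvPolynomial.eval_monomial, Finsupp.prod_fintype]

theorem evP_expand (r : MvPolynomial (Fin 2) ℝ) (z : ℝ × ℝ) :
    evP r z = ∑ m ∈ r.support, r.coeff m * (z.1 ^ m 0 * z.2 ^ m 1) := by
  conv_lhs => rw [r.as_sum]
  rw [evP_sum]
  exact Finset.sum_congr rfl fun m _ => evP_monomial _ _ _

theorem int_Ioo {f : ℝ → ℝ} (hf : Continuous f) : IntegrableOn f (Set.Ioo (0 : ℝ) 1) :=
  (hf.integrableOn_Icc (a := 0) (b := 1)).mono_set Set.Ioo_subset_Icc_self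

theorem int_Sq {f : ℝ × ℝ → ℝ} (hf : Continuous f) : IntegrableOn f (Set.Ioo (0 : ℝ) 1 ×ˢ Set.Ioo (0 : ℝ) 1) := by
  have : IntegrableOn f (Set.Icc (0 : ℝ) 1 ×ˢ Set.Icc (0 : ℝ) 1) :=
    hf.continuousOn.integrableOn_compact (isCompact_Icc.prod isCompact_Icc)
  exact this.mono_set (Set.prod_mono Set.Ioo_subset_Icc_self Set.Ioo_subset_Icc_self)

theorem hasDerivAt_x (f : MvPolynomial (Fin 2) ℝ) (x y : ℝ) :
    HasDerivAt (fun x => evP f (x, y)) (evP (MvPolynomial.pderiv 0 f) (x, y)) x := by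
  induction f using MvPolynomial.induction_on' with
  | monomial m c =>
    rw [MvPolynomial.pderiv_monomial]
    simp only [evP_monomial]
    have := ((hasDerivAt_pow (m 0) x).mul_const (y ^ m 1)).const_mul c
    refine this.congr_deriv ?_
    simp
    ring
  | add p q hp hq =>
    simp only [map_add, evP_add]
    exact hp.add hq

theorem hasDerivAt_y (f : MvPolynomial (Fin 2) ℝ) (x y : ℝ) :
    HasDerivAt (fun y => evP f (x, y)) (evP (MvPolynomial.pderiv 1 f) (x, y)) y := by
  induction f using MvPolynomial.induction_on' with
  | monomial m c =>
    rw [MvPolynomial.pderiv_monomial]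
    simp only [evP_monomial]
    have := ((hasDerivAt_pow (m 1) y).const_mul (x ^ m 0)).const_mul c
    refine this.congr_deriv ?_
    simp
    ring
  | add p q hp hq =>
    simp only [map_add, evP_add]
    exact hp.add hq

theorem ftc {F F' : ℝ → ℝ} (h : ∀ x, HasDerivAt F (F' x) x) (hc : Continuous F') :
    ∫ x in Set.Ioo (0 : ℝ) 1, F' x = F 1 - F 0 := by
  rw [← integral_Ioc_eq_integral_Ioo, ← intervalIntegral.integral_of_le zero_le_one]
  exact intervalIntegral.integral_eq_sub_of_hasDerivAt (fun x _ => h x) (hc.intervalIntegrable _ _)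

theorem green_y (f : MvPolynomial (Fin 2) ℝ) :
    ∫ z in Set.Ioo (0 : ℝ) 1 ×ˢ Set.Ioo (0 : ℝ) 1, evP (MvPolynomial.pderiv 1 f) z =
      (∫ t in Set.Ioo (0 : ℝ) 1, evP f (t, 1)) - ∫ t in Set.Ioo (0 : ℝ) 1, evP f (t, 0) := by
  have hc := evP_cont (MvPolynomial.pderiv 1 f)
  have hc' := evP_cont f
  rw [Measure.volume_eq_prod, setIntegral_prod _ (int_Sq hc), ← integral_sub (int_Ioo (by fun_prop)) (int_Ioo (by fun_prop))]
  congr 1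
  ext x
  exact ftc (fun y => hasDerivAt_y f x y) (by fun_prop)

theorem green_x (f : MvPolynomial (Fin 2) ℝ) :
    ∫ z in Set.Ioo (0 : ℝ) 1 ×ˢ Set.Ioo (0 : ℝ) 1, evP (MvPolynomial.pderiv 0 f) z =
      (∫ t in Set.Ioo (0 : ℝ) 1, evP f (1, t)) - ∫ t in Set.Ioo (0 : ℝ) 1, evP f (0, t) := by
  have hc := evP_cont (MvPolynomial.pderiv 0 f)
  have hc' := evP_cont f
  have hs : Continuous fun z : ℝ × ℝ => evP (MvPolynomial.pderiv 0 f) z.swap :=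
    hc.comp continuous_swap
  rw [Measure.volume_eq_prod, ← setIntegral_prod_swap, setIntegral_prod _ (int_Sq hs), ← integral_sub (int_Ioo (by fun_prop)) (int_Ioo (by fun_prop))]
  congr 1
  ext y
  exact ftc (fun x => hasDerivAt_x f x y) (by fun_prop)

theorem supp_pderiv {i : Fin 2} {r : MvPolynomial (Fin 2) ℝ} {n : ℕ}
    (h : ∀ m ∈ r.support, m 0 + m 1 ≤ n) :
    ∀ m ∈ (MvPolynomial.pderiv i r).support, m 0 + m 1 + 1 ≤ n := by
  intro m hm
  rw [MvPolynomial.mem_support_iff, MvPolynomial.coeff_pderiv] at hm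
  have := h _ (MvPolynomial.mem_support_iff.2 (left_ne_zero_of_mul hm))
  fin_cases i <;> simp at this <;> omega

theorem edge_zero {p : ℕ} {q r : MvPolynomial (Fin 2) ℝ} (i : Fin 4)
    (h : ∀ j < p, ∫ t in Set.Ioo (0 : ℝ) 1, evP q (edgeParam i t) * t ^ j = 0)
    (hr : ∀ m ∈ r.support, m 0 + m 1 + 1 ≤ p) :
    ∫ t in Set.Ioo (0 : ℝ) 1, evP (q * r) (edgeParam i t) = 0 := by
  have hq := evP_cont q
  have he : Continuous (edgeParam i) := by
    fin_cases i <;> simp only [edgeParam] <;> fun_prop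
  have key : ∀ m : Fin 2 →₀ ℕ, ∃ c : ℝ, ∃ j, j ≤ m 0 + m 1 ∧
      ∀ t, (edgeParam i t).1 ^ m 0 * (edgeParam i t).2 ^ m 1 = c * t ^ j := by
    intro m
    fin_cases i
    · exact ⟨0 ^ m 1, m 0, by omega, fun t => by simp [edgeParam]; ring⟩
    · exact ⟨1, m 1, by omega, fun t => by simp [edgeParam]⟩
    · exact ⟨1, m 0, by omega, fun t => by simp [edgeParam]⟩
    · exact ⟨0 ^ m 0, m 1, by omega, fun t => by simp [edgeParam]⟩
  choose c j hj hcj using key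
  have : ∀ t, evP (q * r) (edgeParam i t) =
      ∑ m ∈ r.support, (r.coeff m * c m) * (evP q (edgeParam i t) * t ^ j m) := by
    intro t
    rw [evP_mul, evP_expand r, Finset.mul_sum]
    refine Finset.sum_congr rfl fun m _ => ?_
    rw [hcj]; ring
  simp_rw [this]
  rw [integral_finsetSum _ fun m _ => int_Ioo (by fun_prop)]
  refine Finset.sum_eq_zero fun m hm => ?_
  rw [integral_const_mul, h _ (by have := hj m; have := hr m hm; omega), mul_zero]

theorem bulk_zero {p : ℕ} {q r : MvPolynomial (Fin 2) ℝ}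
    (h : ∀ ab ∈ momIdx p, ∫ z in Set.Ioo (0 : ℝ) 1 ×ˢ Set.Ioo (0 : ℝ) 1, monC ab z * evP q z = 0)
    (hr : ∀ m ∈ r.support, m 0 + m 1 + 2 ≤ p) :
    ∫ z in Set.Ioo (0 : ℝ) 1 ×ˢ Set.Ioo (0 : ℝ) 1, evP (q * r) z = 0 := by
  have hq := evP_cont q
  have hm : ∀ ab, Continuous (monC ab) := fun ab => by unfold monC; fun_prop
  have hpow : ∀ (x : ℝ) (a : ℕ), x ^ a =
      ∑ k ∈ Finset.range (a + 1), (x - 1 / 2) ^ k * ((1 / 2) ^ (a - k) * (a.choose k)) := by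
    intro x a
    conv_lhs => rw [← sub_add_cancel x (1 / 2), add_pow]
    exact Finset.sum_congr rfl fun k _ => by ring
  have : ∀ z, evP (q * r) z =
      ∑ m ∈ r.support, ∑ k ∈ Finset.range (m 0 + 1), ∑ l ∈ Finset.range (m 1 + 1),
        (r.coeff m * ((1 / 2) ^ (m 0 - k) * ((m 0).choose k)) *
          ((1 / 2) ^ (m 1 - l) * ((m 1).choose l))) * (monC (k, l) z * evP q z) := by
    intro z
    rw [evP_mul, evP_expand r, Finset.mul_sum]
    refine Finset.sum_congr rfl fun m _ => ?_
    rw [hpow z.1, hpow z.2, Finset.sum_mul_sum, Finset.mul_sum, Finset.mul_sum]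
    refine Finset.sum_congr rfl fun k _ => ?_
    rw [Finset.mul_sum, Finset.mul_sum]
    refine Finset.sum_congr rfl fun l _ => ?_
    simp only [monC]
    ring
  simp_rw [this]
  rw [integral_finsetSum _ fun m _ => int_Sq (by fun_prop)]
  refine Finset.sum_eq_zero fun m hms => ?_
  rw [integral_finsetSum _ fun m _ => int_Sq (by fun_prop)]
  refine Finset.sum_eq_zero fun k hk => ?_
  rw [integral_finsetSum _ fun m _ => int_Sq (by fun_prop)]
  refine Finset.sum_eq_zero fun l hl => ?_
  rw [integral_const_mul, h, mul_zero]
  have := hr m hms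
  simp only [momIdx, Finset.mem_filter, Finset.mem_product, Finset.mem_range] at hk hl ⊢
  omega

/-- Unisolvence up to constants. -/
theorem unisolv {p : ℕ} {q : MvPolynomial (Fin 2) ℝ} (hdeg : q.totalDegree ≤ p)
    (h1 : ∀ i : Fin 4, ∀ j < p,
      ∫ t in Set.Ioo (0 : ℝ) 1, evP q (edgeParam i t) * t ^ j = 0)
    (h2 : ∀ ab ∈ momIdx p, ∫ z in Set.Ioo (0 : ℝ) 1 ×ˢ Set.Ioo (0 : ℝ) 1, monC ab z * evP q z = 0) :
    MvPolynomial.pderiv 0 q = 0 ∧ MvPolynomial.pderiv 1 q = 0 := by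
  have hs : ∀ m ∈ q.support, m 0 + m 1 ≤ p := by
    intro m hm
    have := MvPolynomial.le_totalDegree hm
    rw [Finsupp.sum_fintype _ _ (fun _ => rfl)] at this
    simp at this
    omega
  have hs1 := fun i => supp_pderiv (i := i) hs
  have hs2 : ∀ i, ∀ m ∈ (MvPolynomial.pderiv i (MvPolynomial.pderiv i q)).support,
      m 0 + m 1 + 2 ≤ p := by
    intro i m hm
    have : ∀ m ∈ (MvPolynomial.pderiv i q).support, m 0 + m 1 ≤ p - 1 := by
      intro m hm; have := hs1 i m hm; omega
    have h3 := supp_pderiv (i := i) this m hm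
    omega
  have c := fun i => evP_cont (MvPolynomial.pderiv i q)
  have c2 := fun i => evP_cont (q * MvPolynomial.pderiv i (MvPolynomial.pderiv i q))
  have hI : ∀ i : Fin 2, ∫ z in Set.Ioo (0 : ℝ) 1 ×ˢ Set.Ioo (0 : ℝ) 1, (evP (MvPolynomial.pderiv i q) z) ^ 2 =
      ∫ z in Set.Ioo (0 : ℝ) 1 ×ˢ Set.Ioo (0 : ℝ) 1, evP (MvPolynomial.pderiv i (q * MvPolynomial.pderiv i q)) z := by
    intro i
    have : ∀ z, evP (MvPolynomial.pderiv i (q * MvPolynomial.pderiv i q)) z =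
      (evP (MvPolynomial.pderiv i q) z) ^ 2 +
        evP (q * MvPolynomial.pderiv i (MvPolynomial.pderiv i q)) z := by
      intro z
      rw [MvPolynomial.pderiv_mul, evP_add, evP_mul, sq]
    simp_rw [this]
    have ci := c i
    rw [integral_add (int_Sq (by fun_prop)) (int_Sq (c2 i)), bulk_zero h2 (hs2 i), add_zero]
  have hz : ∀ i : Fin 2, ∫ z in Set.Ioo (0 : ℝ) 1 ×ˢ Set.Ioo (0 : ℝ) 1, (evP (MvPolynomial.pderiv i q) z) ^ 2 = 0 := by
    intro i
    rw [hI]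
    have e := fun k => edge_zero k (h1 k) (hs1 i)
    fin_cases i
    · refine (green_x _).trans ?_
      have e1 := e 1
      have e3 := e 3
      simp only [edgeParam] at e1 e3
      exact (congrArg₂ (· - ·) e1 e3).trans (sub_zero 0)
    · refine (green_y _).trans ?_
      have e1 := e 2
      have e3 := e 0
      simp only [edgeParam] at e1 e3
      exact (congrArg₂ (· - ·) e1 e3).trans (sub_zero 0)
  have fin : ∀ i : Fin 2, MvPolynomial.pderiv i q = 0 := by
    intro i
    have ci := c i
    have h0 := hz i
    rw [integral_eq_zero_iff_of_nonneg (fun z => sq_nonneg _) (int_Sq (ci.pow 2))] at h0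
    have h4 := Measure.eqOn_open_of_ae_eq h0 (isOpen_Ioo.prod isOpen_Ioo)
      (ci.pow 2).continuousOn continuousOn_const
    refine MvPolynomial.funext_set (fun _ => Set.Ioo (0 : ℝ) 1)
      (fun _ => Set.Ioo_infinite one_pos) fun x hx => ?_
    have h5 := h4 (x := (x 0, x 1)) ⟨hx 0 trivial, hx 1 trivial⟩
    have hxx : (![x 0, x 1] : Fin 2 → ℝ) = x := by
      ext k; fin_cases k <;> rfl
    simpa [evP, hxx] using h5
  exact ⟨fin 0, fin 1⟩

theorem factor {V W E : Type*} [AddCommGroup V] [Module ℝ V] [AddCommGroup W] [Module ℝ W]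
    [AddCommGroup E] [Module ℝ E] (L : V →ₗ[ℝ] E) (G : V →ₗ[ℝ] W)
    (h : LinearMap.ker L ≤ LinearMap.ker G) : ∃ H : E →ₗ[ℝ] W, ∀ v, H (L v) = G v := by
  obtain ⟨H, hH⟩ := LinearMap.exists_extend
    (((LinearMap.ker L).liftQ G h).comp L.quotKerEquivRange.symm.toLinearMap)
  refine ⟨H, fun v => ?_⟩
  have := LinearMap.congr_fun hH ⟨L v, v, rfl⟩
  simp only [LinearMap.comp_apply, Submodule.subtype_apply] at this
  rw [this]
  have e : L.quotKerEquivRange.symm ⟨L v, v, rfl⟩ = (LinearMap.ker L).mkQ v := by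
    rw [LinearEquiv.symm_apply_eq]; rfl
  simp [e]

/-- The degrees of freedom, as a linear map. -/
noncomputable def dofL (p : ℕ) :
    MvPolynomial (Fin 2) ℝ →ₗ[ℝ] ((Fin 4 × Fin p) ⊕ momIdx p → ℝ) where
  toFun q := Sum.elim
    (fun ij => ∫ t in Set.Ioo (0 : ℝ) 1, evP q (edgeParam ij.1 t) * t ^ (ij.2 : ℕ))
    (fun ab => ∫ z in Set.Ioo (0 : ℝ) 1 ×ˢ Set.Ioo (0 : ℝ) 1, monC ab z * evP q z)
  map_add' q r := by
    have hq := evP_cont q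
    have hr := evP_cont r
    ext (⟨i, j⟩ | ab)
    · have he : Continuous (edgeParam i) := by
        fin_cases i <;> simp only [edgeParam] <;> fun_prop
      simp only [Sum.elim_inl, Pi.add_apply, evP_add, add_mul]
      exact integral_add (int_Ioo (by fun_prop)) (int_Ioo (by fun_prop))
    · have hm : Continuous (monC ab) := by unfold monC; fun_prop
      simp only [Sum.elim_inr, Pi.add_apply, evP_add, mul_add]
      exact integral_add (int_Sq (by fun_prop)) (int_Sq (by fun_prop))
  map_smul' c q := by
    ext (⟨i, j⟩ | ab)
    · simp only [Sum.elim_inl, Pi.smul_apply, evP_smul, mul_assoc, smul_eq_mul, RingHom.id_apply]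
      exact integral_const_mul _ _
    · simp only [Sum.elim_inr, Pi.smul_apply, evP_smul, mul_left_comm _ c, smul_eq_mul,
        RingHom.id_apply]
      exact integral_const_mul _ _

/-- lower stability bound for the "dofi-dofi" stabilization of the
nodal nonconforming virtual element space on the unit square, for polynomials
of total degree ≤ p:
`|q|²_{1,K} ≤ C (Σ_e Σ_{j<p} (∫_e q t^j)² + Σ_{|α| ≤ p−2} (∫_K m_α q)²)`. -/
theorem stmt_9 (p : ℕ) (hp : 1 ≤ p) :
    ∃ C : ℝ, 0 < C ∧ ∀ q : MvPolynomial (Fin 2) ℝ, q.totalDegree ≤ p →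
      (∫ z in Set.Ioo (0 : ℝ) 1 ×ˢ Set.Ioo (0 : ℝ) 1, gradSqP q z) ≤
        C * ((∑ i : Fin 4, ∑ j ∈ Finset.range p,
            (∫ t in Set.Ioo (0 : ℝ) 1, evP q (edgeParam i t) * t ^ j) ^ 2) +
          ∑ ab ∈ momIdx p,
            (∫ z in Set.Ioo (0 : ℝ) 1 ×ˢ Set.Ioo (0 : ℝ) 1, monC ab z * evP q z) ^ 2) := by
  classical
  let V := MvPolynomial.restrictTotalDegree (Fin 2) ℝ p
  let G : MvPolynomial (Fin 2) ℝ →ₗ[ℝ] MvPolynomial (Fin 2) ℝ × MvPolynomial (Fin 2) ℝ :=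
    (MvPolynomial.pderiv (R := ℝ) (0 : Fin 2)).toLinearMap.prod
      (MvPolynomial.pderiv (R := ℝ) (1 : Fin 2)).toLinearMap
  obtain ⟨H, hH⟩ := factor ((dofL p).comp V.subtype) (G.comp V.subtype) (by
    rintro ⟨q, hq⟩ hk
    rw [LinearMap.mem_ker] at hk ⊢
    have hu := unisolv ((MvPolynomial.mem_restrictTotalDegree _ _ q).1 hq)
      (fun i j hj => congrFun hk (Sum.inl (i, ⟨j, hj⟩)))
      (fun ab hab => congrFun hk (Sum.inr ⟨ab, hab⟩))
    exact Prod.ext hu.1 hu.2)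
  let e := fun k : (Fin 4 × Fin p) ⊕ momIdx p => H (fun j => if k = j then 1 else 0)
  let D : ℝ × ℝ → ℝ := fun z => ∑ k, ((evP (e k).1 z) ^ 2 + (evP (e k).2 z) ^ 2)
  have hDc : Continuous D := by
    have a := fun k => evP_cont (e k).1
    have b := fun k => evP_cont (e k).2
    fun_prop
  have hD0 : 0 ≤ ∫ z in Set.Ioo (0 : ℝ) 1 ×ˢ Set.Ioo (0 : ℝ) 1, D z :=
    integral_nonneg fun z => Finset.sum_nonneg fun k _ => by positivity
  refine ⟨(∫ z in Set.Ioo (0 : ℝ) 1 ×ˢ Set.Ioo (0 : ℝ) 1, D z) + 1, by linarith, fun q hq => ?_⟩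
  have hS : (∑ i : Fin 4, ∑ j ∈ Finset.range p,
            (∫ t in Set.Ioo (0 : ℝ) 1, evP q (edgeParam i t) * t ^ j) ^ 2) +
          ∑ ab ∈ momIdx p,
            (∫ z in Set.Ioo (0 : ℝ) 1 ×ˢ Set.Ioo (0 : ℝ) 1, monC ab z * evP q z) ^ 2
      = ∑ k, (dofL p q k) ^ 2 := by
    rw [Fintype.sum_sum_type, Fintype.sum_prod_type]
    congr 1
    · refine Finset.sum_congr rfl fun i _ => ?_
      rw [Finset.sum_range]
      rfl
    · rw [← Finset.sum_coe_sort]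
      rfl
  rw [hS]
  have hrep : G q = ∑ k, dofL p q k • e k := by
    refine (hH ⟨q, (MvPolynomial.mem_restrictTotalDegree _ _ q).2 hq⟩).symm.trans ?_
    exact LinearMap.pi_apply_eq_sum_univ H _
  have hx : MvPolynomial.pderiv 0 q = ∑ k, dofL p q k • (e k).1 := by
    have := congrArg Prod.fst hrep
    rw [Prod.fst_sum] at this
    exact this
  have hy : MvPolynomial.pderiv 1 q = ∑ k, dofL p q k • (e k).2 := by
    have := congrArg Prod.snd hrep
    rw [Prod.snd_sum] at this
    exact this
  have hpt : ∀ z, gradSqP q z ≤ (∑ k, (dofL p q k) ^ 2) * D z := by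
    intro z
    simp only [gradSqP, D, hx, hy, evP_sum, evP_smul, Finset.sum_add_distrib, mul_add]
    exact add_le_add (Finset.sum_mul_sq_le_sq_mul_sq _ _ _) (Finset.sum_mul_sq_le_sq_mul_sq _ _ _)
  have hgc : Continuous (gradSqP q) := by
    have a := evP_cont (MvPolynomial.pderiv 0 q)
    have b := evP_cont (MvPolynomial.pderiv 1 q)
    unfold gradSqP
    fun_prop
  have hle := integral_mono (μ := volume.restrict (Set.Ioo (0 : ℝ) 1 ×ˢ Set.Ioo (0 : ℝ) 1))
    (int_Sq hgc) (int_Sq (hDc.const_mul (∑ k, (dofL p q k) ^ 2))) hpt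
  rw [integral_const_mul] at hle
  have hS0 : 0 ≤ ∑ k, (dofL p q k) ^ 2 := Finset.sum_nonneg fun k _ => sq_nonneg _
  nlinarith
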